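/- arXiv:2201.12095 — 12 statements merged into one kernel-verified Lean document; each statement's English description precedes it below -/
import Mathlib

section
/- Let F be a Riesz algebra. Then the algebra multiplication in F is both left and right r-continuous: whenever a net (x_α) in F r-converges to x ∈ F, then for every y ∈ F the net (y·x_α) r-converges to y·x and the net (x_α·y) r-converges to x·y. -/
universe u

section RieszDefs

variable {X : Type u} [Lattice X] [AddCommGroup X] [Module ℝ X]

/-- A net `x : A → X` order converges to `x₀`:  there is a set `D` (the range of a
net `y_β ↓ 0`), downward directed with infimum `0`, such that for each `d ∈ D`
eventually `|x α - x₀| ≤ d`. -/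
def OConv {A : Type u} [Preorder A] (x : A → X) (x₀ : X) : Prop :=
  ∃ D : Set X, D.Nonempty ∧ DirectedOn (· ≥ ·) D ∧ IsGLB D 0 ∧
    ∀ d ∈ D, ∃ α₀ : A, ∀ α, α₀ ≤ α → |x α - x₀| ≤ d

/-- A net `x : A → X` relatively uniformly converges to `x₀`. -/
def RConv {A : Type u} [Preorder A] (x : A → X) (x₀ : X) : Prop :=
  ∃ u : X, 0 ≤ u ∧ ∀ n : ℕ, ∃ α₀ : A, ∀ α, α₀ ≤ α → |x α - x₀| ≤ ((n : ℝ) + 1)⁻¹ • u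

end RieszDefs

/-- Archimedean Riesz space: `(1/n)u ↓ 0` for every `u ≥ 0`. -/
def ArchRiesz (X : Type u) [Lattice X] [AddCommGroup X] [Module ℝ X] : Prop :=
  ∀ u : X, 0 ≤ u → IsGLB (Set.range fun n : ℕ => ((n : ℝ) + 1)⁻¹ • u) (0 : X)

/-- A set is order bounded if contained in some order interval. -/
def OrdBounded {X : Type u} [Preorder X] (B : Set X) : Prop :=
  ∃ a b : X, B ⊆ Set.Icc a b

section AlgDefs

variable {F : Type u} [NonUnitalRing F] [Lattice F] [Module ℝ F]

/-- Left multiplicative order convergence. -/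
def MlOConv {A : Type u} [Preorder A] (x : A → F) (x₀ : F) : Prop :=
  ∀ u : F, 0 ≤ u → OConv (fun α => u * |x α - x₀|) (0 : F)

/-- Right multiplicative order convergence. -/
def MrOConv {A : Type u} [Preorder A] (x : A → F) (x₀ : F) : Prop :=
  ∀ u : F, 0 ≤ u → OConv (fun α => |x α - x₀| * u) (0 : F)

/-- Multiplicative order convergence. -/
def MOConv {A : Type u} [Preorder A] (x : A → F) (x₀ : F) : Prop :=
  MlOConv x x₀ ∧ MrOConv x x₀

/-- Left multiplicative r-convergence. -/
def MlRConv {A : Type u} [Preorder A] (x : A → F) (x₀ : F) : Prop :=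
  ∀ u : F, 0 ≤ u → RConv (fun α => u * |x α - x₀|) (0 : F)

/-- Right multiplicative r-convergence. -/
def MrRConv {A : Type u} [Preorder A] (x : A → F) (x₀ : F) : Prop :=
  ∀ u : F, 0 ≤ u → RConv (fun α => |x α - x₀| * u) (0 : F)

/-- The net `z` is mo-Cauchy. -/
def MOCauchy {A : Type u} [Preorder A] (z : A → F) : Prop :=
  ∀ u : F, 0 ≤ u → ∃ D : Set F, D.Nonempty ∧ DirectedOn (· ≥ ·) D ∧ IsGLB D 0 ∧
    ∀ d ∈ D, ∃ α₀ : A, ∀ α₁, α₀ ≤ α₁ → ∀ α₂, α₀ ≤ α₂ →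
      u * |z α₁ - z α₂| ≤ d ∧ |z α₁ - z α₂| * u ≤ d

/-- The net `z` is m_l o-Cauchy. -/
def MlOCauchy {A : Type u} [Preorder A] (z : A → F) : Prop :=
  ∀ u : F, 0 ≤ u → ∃ D : Set F, D.Nonempty ∧ DirectedOn (· ≥ ·) D ∧ IsGLB D 0 ∧
    ∀ d ∈ D, ∃ α₀ : A, ∀ α₁, α₀ ≤ α₁ → ∀ α₂, α₀ ≤ α₂ →
      u * |z α₁ - z α₂| ≤ d

end AlgDefs

/-- In a Riesz algebra the modulus is submultiplicative. -/
theorem abs_mul_le_abs_mul_abs {F : Type*} [NonUnitalRing F] [Lattice F] [Module ℝ F]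
    [AddLeftMono F] [PosSMulMono ℝ F]
    (hmul : ∀ x y : F, 0 ≤ x → 0 ≤ y → 0 ≤ x * y) (y z : F) :
    |y * z| ≤ |y| * |z| := by
  have key : ∀ a b : F, a * b ≤ |a| * |b| := by
    intro a b
    have ha : 0 ≤ |a| - a := sub_nonneg.2 (le_abs_self a)
    have ha' : 0 ≤ |a| + a := neg_le_iff_add_nonneg.1 (neg_le_abs a)
    have hb : 0 ≤ |b| - b := sub_nonneg.2 (le_abs_self b)
    have hb' : 0 ≤ |b| + b := neg_le_iff_add_nonneg.1 (neg_le_abs b)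
    have h := add_nonneg (hmul _ _ ha hb') (hmul _ _ ha' hb)
    have e : (|a| - a) * (|b| + b) + (|a| + a) * (|b| - b) = (2 : ℝ) • (|a| * |b| - a * b) := by
      rw [two_smul]
      noncomm_ring
    rw [e] at h
    have h2 := smul_nonneg (show (0 : ℝ) ≤ 2⁻¹ by norm_num) h
    rw [smul_smul, inv_mul_cancel₀ (two_ne_zero' ℝ), one_smul] at h2
    exact sub_nonneg.1 h2
  refine abs_le'.2 ⟨key y z, ?_⟩
  simpa using key (-y) z

/-- In any Riesz algebra `F`, the algebra multiplication is both left and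
right r-continuous. -/
theorem mul_left_right_r_continuous {F : Type u}
    [NonUnitalRing F] [Lattice F] [Module ℝ F]
    [CovariantClass F F (· + ·) (· ≤ ·)] [PosSMulMono ℝ F]
    [IsScalarTower ℝ F F] [SMulCommClass ℝ F F]
    (hmul : ∀ x y : F, 0 ≤ x → 0 ≤ y → 0 ≤ x * y)
    {A : Type u} [Preorder A] [IsDirected A (· ≤ ·)] [Nonempty A]
    (x : A → F) (x₀ : F) (hx : RConv x x₀) (y : F) :
    RConv (fun α => y * x α) (y * x₀) ∧ RConv (fun α => x α * y) (x₀ * y) := by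
  obtain ⟨u, hu, h⟩ := hx
  have hy : 0 ≤ |y| := abs_nonneg y
  refine ⟨⟨|y| * u, hmul _ _ hy hu, fun n => ?_⟩, ⟨u * |y|, hmul _ _ hu hy, fun n => ?_⟩⟩
  all_goals
    obtain ⟨α₀, h₀⟩ := h n
    refine ⟨α₀, fun α hα => ?_⟩
    have hd := sub_nonneg.2 (h₀ α hα)
  · have hm := hmul _ _ hy hd
    rw [mul_sub, sub_nonneg, mul_smul_comm] at hm
    rw [← mul_sub]
    exact (abs_mul_le_abs_mul_abs hmul _ _).trans hm
  · have hm := hmul _ _ hd hy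
    rw [sub_mul, sub_nonneg, smul_mul_assoc] at hm
    rw [← sub_mul]
    exact (abs_mul_le_abs_mul_abs hmul _ _).trans hm
end

section
/- Let X be a Riesz space and F an Archimedean Riesz algebra. Then every rr-continuous linear operator T : X → F is rmo-continuous; that is, if a net (x_α) r-converges to x in X, then (Tx_α) mo-converges to Tx in F (i.e. u·|Tx_α − Tx| →o 0 and |Tx_α − Tx|·u →o 0 for every u ∈ F_+). -/
universe u

section Helpers

variable {F : Type u}

/-- Translation-invariance of the order, as an ordered group instance. -/
theorem IsOrderedAddMonoid.of_covariantClass (F : Type u) [PartialOrder F] [AddCommGroup F]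
    [CovariantClass F F (· + ·) (· ≤ ·)] : IsOrderedAddMonoid F where
  add_le_add_left _ _ h c := by
    simpa only [add_comm] using CovariantClass.elim (μ := (· + ·)) c h

/-- In an Archimedean Riesz space, a net of positive elements that is `r`-null is `o`-null. -/
theorem OConv.of_le_inv_smul [Lattice F] [AddCommGroup F] [Module ℝ F]
    [CovariantClass F F (· + ·) (· ≤ ·)] [PosSMulMono ℝ F] (hArch : ArchRiesz F)
    {A : Type u} [Preorder A] {y : A → F} {w : F} (hw : 0 ≤ w) (hy : ∀ α, 0 ≤ y α)
    (h : ∀ n : ℕ, ∃ α₀ : A, ∀ α, α₀ ≤ α → y α ≤ ((n : ℝ) + 1)⁻¹ • w) :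
    OConv y 0 := by
  have := IsOrderedAddMonoid.of_covariantClass F
  have anti : Antitone fun n : ℕ => ((n : ℝ) + 1)⁻¹ • w := fun m n hmn =>
    smul_le_smul_of_nonneg_right (by gcongr) hw
  refine ⟨_, Set.range_nonempty _, ?_, hArch w hw, ?_⟩
  · rintro _ ⟨m, rfl⟩ _ ⟨n, rfl⟩
    exact ⟨_, ⟨max m n, rfl⟩, anti (le_max_left m n), anti (le_max_right m n)⟩
  · rintro _ ⟨n, rfl⟩
    obtain ⟨α₀, hα₀⟩ := h n
    refine ⟨α₀, fun α hα => ?_⟩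
    rw [sub_zero, abs_of_nonneg (hy α)]
    exact hα₀ α hα

/-- In an Archimedean Riesz algebra, `r`-convergence implies `mo`-convergence. -/
theorem RConv.moConv [NonUnitalRing F] [Lattice F] [Module ℝ F]
    [CovariantClass F F (· + ·) (· ≤ ·)] [PosSMulMono ℝ F]
    [IsScalarTower ℝ F F] [SMulCommClass ℝ F F]
    (hmul : ∀ x y : F, 0 ≤ x → 0 ≤ y → 0 ≤ x * y) (hArch : ArchRiesz F)
    {A : Type u} [Preorder A] {y : A → F} {y₀ : F} (hy : RConv y y₀) : MOConv y y₀ := by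
  have := IsOrderedAddMonoid.of_covariantClass F
  obtain ⟨w, hw, h⟩ := hy
  refine ⟨fun u hu => OConv.of_le_inv_smul hArch (hmul u w hu hw)
      (fun α => hmul _ _ hu (abs_nonneg _)) fun n => ?_,
    fun u hu => OConv.of_le_inv_smul hArch (hmul w u hw hu)
      (fun α => hmul _ _ (abs_nonneg _) hu) fun n => ?_⟩
  · obtain ⟨α₀, hα₀⟩ := h n
    refine ⟨α₀, fun α hα => ?_⟩
    have key := hmul _ _ hu (sub_nonneg.mpr (hα₀ α hα))
    rwa [mul_sub, mul_smul_comm, sub_nonneg] at key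
  · obtain ⟨α₀, hα₀⟩ := h n
    refine ⟨α₀, fun α hα => ?_⟩
    have key := hmul _ _ (sub_nonneg.mpr (hα₀ α hα)) hu
    rwa [sub_mul, smul_mul_assoc, sub_nonneg] at key

end Helpers

/-- Every rr-continuous linear operator from a Riesz space `X` to an
Archimedean Riesz algebra `F` is rmo-continuous. -/
theorem rr_continuous_implies_rmo_continuous {X F : Type u}
    [Lattice X] [AddCommGroup X] [Module ℝ X]
    [CovariantClass X X (· + ·) (· ≤ ·)] [PosSMulMono ℝ X]
    [NonUnitalRing F] [Lattice F] [Module ℝ F]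
    [CovariantClass F F (· + ·) (· ≤ ·)] [PosSMulMono ℝ F]
    [IsScalarTower ℝ F F] [SMulCommClass ℝ F F]
    (hmul : ∀ x y : F, 0 ≤ x → 0 ≤ y → 0 ≤ x * y)
    (hArch : ArchRiesz F)
    (T : X →ₗ[ℝ] F)
    (hT : ∀ (A : Type u) [Preorder A] [IsDirected A (· ≤ ·)] [Nonempty A],
      ∀ (x : A → X) (x₀ : X), RConv x x₀ → RConv (fun α => T (x α)) (T x₀))
    {A : Type u} [Preorder A] [IsDirected A (· ≤ ·)] [Nonempty A]
    (x : A → X) (x₀ : X) (hx : RConv x x₀) :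
    MOConv (fun α => T (x α)) (T x₀) :=
  (hT A x x₀ hx).moConv hmul hArch
end

section
/- Let X be a Riesz space and F an Archimedean Riesz algebra. Then: (1) every regular linear operator T : X → F is rr-continuous; (2) every rr-continuous linear operator T : X → F is both rm_l r-continuous and rm_r r-continuous; (3) every linear operator T : X → F which is both rm_l r-continuous and rm_r r-continuous is rmo-continuous. In particular, the class of regular operators is contained in the rr-continuous operators, which is contained in the intersection of the rm_l r-continuous and rm_r r-continuous operators, which is contained in the rmo-continuous operators. -/
universe u

section OpDefs

variable {X F : Type u} [Lattice X] [AddCommGroup X] [Module ℝ X]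
  [NonUnitalRing F] [Lattice F] [Module ℝ F]

/-- `T` is rr-continuous. -/
def RRCont (T : X →ₗ[ℝ] F) : Prop :=
  ∀ (A : Type u) [Preorder A] [IsDirected A (· ≤ ·)] [Nonempty A],
    ∀ (x : A → X) (x₀ : X), RConv x x₀ → RConv (fun α => T (x α)) (T x₀)

/-- `T` is rm_l r-continuous. -/
def RMlRCont (T : X →ₗ[ℝ] F) : Prop :=
  ∀ (A : Type u) [Preorder A] [IsDirected A (· ≤ ·)] [Nonempty A],
    ∀ (x : A → X) (x₀ : X), RConv x x₀ → MlRConv (fun α => T (x α)) (T x₀)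

/-- `T` is rm_r r-continuous. -/
def RMrRCont (T : X →ₗ[ℝ] F) : Prop :=
  ∀ (A : Type u) [Preorder A] [IsDirected A (· ≤ ·)] [Nonempty A],
    ∀ (x : A → X) (x₀ : X), RConv x x₀ → MrRConv (fun α => T (x α)) (T x₀)

/-- `T` is rmo-continuous. -/
def RMOCont (T : X →ₗ[ℝ] F) : Prop :=
  ∀ (A : Type u) [Preorder A] [IsDirected A (· ≤ ·)] [Nonempty A],
    ∀ (x : A → X) (x₀ : X), RConv x x₀ → MOConv (fun α => T (x α)) (T x₀)

end OpDefs

theorem RConv.of_abs_sub_le_map {X F : Type u}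
    [Lattice X] [AddCommGroup X] [Module ℝ X]
    [Lattice F] [AddCommGroup F] [Module ℝ F] [IsOrderedAddMonoid F]
    {A : Type u} [Preorder A] {x : A → X} {x₀ : X} (hx : RConv x x₀)
    (P : X →ₗ[ℝ] F) (hP : Monotone P) {y : A → F} {y₀ : F}
    (hy : ∀ α, |y α - y₀| ≤ P |x α - x₀|) : RConv y y₀ := by
  obtain ⟨u, hu, h⟩ := hx
  refine ⟨P u, by simpa using hP hu, fun n => ?_⟩
  obtain ⟨α₀, hα₀⟩ := h n
  refine ⟨α₀, fun α hα => (hy α).trans ?_⟩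
  simpa using hP (hα₀ α hα)

theorem LinearMap.monotone_of_nonneg {X F : Type*}
    [Lattice X] [AddCommGroup X] [Module ℝ X] [IsOrderedAddMonoid X]
    [Lattice F] [AddCommGroup F] [Module ℝ F] [IsOrderedAddMonoid F]
    (P : X →ₗ[ℝ] F) (hP : ∀ v, 0 ≤ v → 0 ≤ P v) : Monotone P := by
  intro a b hab
  have h := hP (b - a) (sub_nonneg.2 hab)
  rwa [map_sub, sub_nonneg] at h

theorem LinearMap.abs_sub_apply_le {X F : Type*}
    [Lattice X] [AddCommGroup X] [Module ℝ X] [IsOrderedAddMonoid X]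
    [Lattice F] [AddCommGroup F] [Module ℝ F] [IsOrderedAddMonoid F]
    (P Q : X →ₗ[ℝ] F) (hP : Monotone P) (hQ : Monotone Q) (v : X) :
    |(P - Q) v| ≤ (P + Q) |v| := by
  have hP₁ := hP (le_abs_self v)
  have hP₂ := hP (neg_le_abs v)
  have hQ₁ := hQ (le_abs_self v)
  have hQ₂ := hQ (neg_le_abs v)
  rw [map_neg] at hP₂ hQ₂
  refine sup_le ?_ ?_
  · simpa [sub_eq_add_neg] using add_le_add hP₁ hQ₂
  · simpa [sub_eq_add_neg, add_comm] using add_le_add hP₂ hQ₁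

theorem RConv.oConv {F : Type u}
    [Lattice F] [AddCommGroup F] [Module ℝ F] [IsOrderedAddMonoid F] [PosSMulMono ℝ F]
    (hArch : ArchRiesz F) {A : Type u} [Preorder A] {x : A → F} {x₀ : F}
    (hx : RConv x x₀) : OConv x x₀ := by
  obtain ⟨u, hu, h⟩ := hx
  have hanti : Antitone fun n : ℕ => ((n : ℝ) + 1)⁻¹ • u := by
    intro m n hmn
    have hle : ((n : ℝ) + 1)⁻¹ ≤ ((m : ℝ) + 1)⁻¹ := by gcongr
    have h0 := smul_nonneg (sub_nonneg.2 hle) hu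
    rwa [sub_smul, sub_nonneg] at h0
  refine ⟨_, Set.range_nonempty _, ?_, hArch u hu, ?_⟩
  · rintro _ ⟨m, rfl⟩ _ ⟨n, rfl⟩
    exact ⟨_, ⟨max m n, rfl⟩, hanti (le_max_left m n), hanti (le_max_right m n)⟩
  · rintro _ ⟨n, rfl⟩
    exact h n

/-- For a Riesz space `X` and an Archimedean Riesz algebra `F`:
regular ⊆ rr-continuous ⊆ (rm_l r-continuous ∩ rm_r r-continuous) ⊆ rmo-continuous. -/
theorem regular_subset_rr_subset_rml_rmr_subset_rmo {X F : Type u}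
    [Lattice X] [AddCommGroup X] [Module ℝ X]
    [CovariantClass X X (· + ·) (· ≤ ·)] [PosSMulMono ℝ X]
    [NonUnitalRing F] [Lattice F] [Module ℝ F]
    [CovariantClass F F (· + ·) (· ≤ ·)] [PosSMulMono ℝ F]
    [IsScalarTower ℝ F F] [SMulCommClass ℝ F F]
    (hmul : ∀ x y : F, 0 ≤ x → 0 ≤ y → 0 ≤ x * y)
    (hArch : ArchRiesz F) :
    (∀ T : X →ₗ[ℝ] F,
        (∃ T₁ T₂ : X →ₗ[ℝ] F, (∀ v : X, 0 ≤ v → 0 ≤ T₁ v) ∧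
          (∀ v : X, 0 ≤ v → 0 ≤ T₂ v) ∧ T = T₁ - T₂) → RRCont T) ∧
    (∀ T : X →ₗ[ℝ] F, RRCont T → RMlRCont T ∧ RMrRCont T) ∧
    (∀ T : X →ₗ[ℝ] F, RMlRCont T ∧ RMrRCont T → RMOCont T) := by
  have : IsOrderedAddMonoid X :=
    { add_le_add_left := fun a b hab c => by
        simpa [add_comm] using CovariantClass.elim (μ := (· + ·)) (r := (· ≤ ·)) c hab }
  have : IsOrderedAddMonoid F :=
    { add_le_add_left := fun a b hab c => by
        simpa [add_comm] using CovariantClass.elim (μ := (· + ·)) (r := (· ≤ ·)) c hab }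
  refine ⟨?_, ?_, ?_⟩
  · rintro _ ⟨P, Q, hP, hQ, rfl⟩ A _ _ _ x x₀ hx
    have hP := P.monotone_of_nonneg hP
    have hQ := Q.monotone_of_nonneg hQ
    refine hx.of_abs_sub_le_map (P + Q) (fun a b hab => add_le_add (hP hab) (hQ hab)) fun α => ?_
    rw [← map_sub]
    exact P.abs_sub_apply_le Q hP hQ _
  · refine fun T hT => ⟨fun A _ _ _ x x₀ hx u hu => ?_, fun A _ _ _ x x₀ hx u hu => ?_⟩
    · refine (hT A x x₀ hx).of_abs_sub_le_map (LinearMap.mulLeft ℝ u)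
        (LinearMap.monotone_of_nonneg _ fun v hv => hmul u v hu hv) fun α => ?_
      rw [sub_zero, abs_of_nonneg (hmul _ _ hu (abs_nonneg _)), LinearMap.mulLeft_apply]
    · refine (hT A x x₀ hx).of_abs_sub_le_map (LinearMap.mulRight ℝ u)
        (LinearMap.monotone_of_nonneg _ fun v hv => hmul v u hv hu) fun α => ?_
      rw [sub_zero, abs_of_nonneg (hmul _ _ (abs_nonneg _) hu), LinearMap.mulRight_apply]
  · exact fun T hT A _ _ _ x x₀ hx =>
      ⟨fun u hu => (hT.1 A x x₀ hx u hu).oConv hArch,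
        fun u hu => (hT.2 A x x₀ hx u hu).oConv hArch⟩
end

section
/- Let E be a Riesz algebra. The following conditions are equivalent: (i) E is a right d-algebra (i.e. (x ∧ y)·u = (x·u) ∧ (y·u) for all x, y ∈ E and all u ∈ E_+) whose algebra multiplication is right o-continuous (i.e. x_α →o x implies x_α·y →o x·y for every y ∈ E); (ii) for every u ∈ E_+ and every subset A ⊆ E such that inf A exists in E, the infimum of the set A·u = {a·u : a ∈ A} exists and equals (inf A)·u; (iii) for every u ∈ E_+ and every subset A ⊆ E such that sup A exists in E, the supremum of the set A·u exists and equals (sup A)·u. -/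
universe u

section PositiveMultiplication

variable {E : Type u} [NonUnitalRing E] [Lattice E] [AddLeftMono E]

theorem mul_le_mul_right_of_mul_nonneg (hmul : ∀ x y : E, 0 ≤ x → 0 ≤ y → 0 ≤ x * y)
    {x y u : E} (hu : 0 ≤ u) (h : x ≤ y) : x * u ≤ y * u := by
  have := hmul (y - x) u (sub_nonneg.2 h) hu
  rwa [sub_mul, sub_nonneg] at this

theorem abs_mul_le_abs_mul_abs_of_mul_nonneg
    (hmul : ∀ x y : E, 0 ≤ x → 0 ≤ y → 0 ≤ x * y) (a y : E) : |a * y| ≤ |a| * |y| := by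
  have key (b : E) : b * y ≤ |b| * |y| := by
    have h₁ := hmul (|b| - b) y⁺ (sub_nonneg.2 (le_abs_self b)) (posPart_nonneg y)
    have h₂ := hmul (|b| + b) y⁻ (neg_le_iff_add_nonneg.1 (neg_le_abs b)) (negPart_nonneg y)
    have h₃ : |b| * |y| - b * y = (|b| - b) * y⁺ + (|b| + b) * y⁻ := by
      nth_rewrite 2 [← posPart_sub_negPart y]
      rw [← posPart_add_negPart y]
      noncomm_ring
    exact sub_nonneg.1 (h₃ ▸ add_nonneg h₁ h₂)
  refine abs_le'.2 ⟨key a, ?_⟩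
  simpa using key (-a)

theorem IsGLB.nonempty_of_nontrivial [Nontrivial E] {S : Set E} {a : E}
    (h : IsGLB S a) : S.Nonempty := by
  by_contra hS
  obtain rfl := Set.not_nonempty_iff_eq_empty.1 hS
  have top (x : E) : x ≤ a := h.2 (by simp)
  have nonpos (x : E) : x ≤ 0 := by simpa using top (a + x)
  obtain ⟨x, hx⟩ := exists_ne (0 : E)
  exact hx (le_antisymm (nonpos x) (by simpa using nonpos (-x)))

theorem isGLB_image_mul_right_of_oConv [Module ℝ E]
    (hmul : ∀ x y : E, 0 ≤ x → 0 ≤ y → 0 ≤ x * y)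
    {u : E} (hu : 0 ≤ u) (hinf : ∀ x y : E, (x ⊓ y) * u = (x * u) ⊓ (y * u))
    (hcont : ∀ (A : Type u) [Preorder A] [IsDirected A (· ≤ ·)] [Nonempty A],
      ∀ (xa : A → E) (x : E), OConv xa x → OConv (fun α => xa α * u) (x * u))
    {S : Set E} {a : E} (hS : IsGLB S a) : IsGLB ((fun s => s * u) '' S) (a * u) := by
  refine ⟨?_, fun b hb => ?_⟩
  · rintro _ ⟨s, hs, rfl⟩
    exact mul_le_mul_right_of_mul_nonneg hmul hu (hS.1 hs)
  cases subsingleton_or_nontrivial E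
  · exact (Subsingleton.elim _ _).le
  have hbT : infClosure S ⊆ {t | b ≤ t * u} :=
    infClosure_min (fun s hs => hb ⟨s, hs, rfl⟩) fun x hx y hy => by
      simpa [hinf] using And.intro hx hy
  have hT : IsGLB (infClosure S) a := by rwa [isGLB_infClosure]
  have hTne : (infClosure S).Nonempty := hT.nonempty_of_nontrivial
  have hTinf : InfClosed (infClosure S) := infClosed_infClosure
  have : Nonempty (infClosure S)ᵒᵈ := hTne.to_subtype
  have : IsDirected (infClosure S)ᵒᵈ (· ≤ ·) :=
    ⟨fun x y => ⟨OrderDual.toDual ⟨_, hTinf (OrderDual.ofDual x).2 (OrderDual.ofDual y).2⟩,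
      inf_le_left (α := E), inf_le_right (α := E)⟩⟩
  have hconv : OConv (fun t : (infClosure S)ᵒᵈ => ((OrderDual.ofDual t : infClosure S) : E)) a := by
    refine ⟨(fun t => t - a) '' infClosure S, hTne.image _, ?_, ⟨?_, fun c hc => ?_⟩, ?_⟩
    · rintro _ ⟨x, hx, rfl⟩ _ ⟨y, hy, rfl⟩
      exact ⟨_, ⟨_, hTinf hx hy, rfl⟩, sub_le_sub_right inf_le_left a,
        sub_le_sub_right inf_le_right a⟩
    · rintro _ ⟨t, ht, rfl⟩
      exact sub_nonneg.2 (hT.1 ht)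
    · have : c + a ≤ a := hT.2 fun t ht => le_sub_iff_add_le.1 (hc ⟨t, ht, rfl⟩)
      simpa using this
    · rintro _ ⟨t, ht, rfl⟩
      refine ⟨OrderDual.toDual ⟨t, ht⟩, fun s hs => ?_⟩
      have hst : ((OrderDual.ofDual s : infClosure S) : E) ≤ t := hs
      rw [abs_of_nonneg (sub_nonneg.2 (hT.1 (OrderDual.ofDual s).2))]
      exact sub_le_sub_right hst a
  obtain ⟨D, -, -, hD, hev⟩ := hcont _ _ _ hconv
  refine sub_nonpos.1 (hD.2 fun d hd => ?_)
  obtain ⟨t, ht⟩ := hev d hd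
  exact (sub_le_sub_right (hbT (OrderDual.ofDual t).2) _).trans
    ((le_abs_self _).trans (ht t le_rfl))

theorem OConv.mul_right_of_isGLB [Module ℝ E]
    (hmul : ∀ x y : E, 0 ≤ x → 0 ≤ y → 0 ≤ x * y) {y : E}
    (hglb : ∀ (S : Set E) (a : E), IsGLB S a → IsGLB ((fun s => s * |y|) '' S) (a * |y|))
    {A : Type u} [Preorder A] {xa : A → E} {x : E} (h : OConv xa x) :
    OConv (fun α => xa α * y) (x * y) := by
  obtain ⟨D, hne, hdir, hD, hev⟩ := h
  refine ⟨(fun d => d * |y|) '' D, hne.image _, ?_, by simpa using hglb D 0 hD, ?_⟩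
  · rintro _ ⟨c, hc, rfl⟩ _ ⟨d, hd, rfl⟩
    obtain ⟨e, he, hec, hed⟩ := hdir c hc d hd
    exact ⟨_, ⟨e, he, rfl⟩, mul_le_mul_right_of_mul_nonneg hmul (abs_nonneg y) hec,
      mul_le_mul_right_of_mul_nonneg hmul (abs_nonneg y) hed⟩
  · rintro _ ⟨d, hd, rfl⟩
    obtain ⟨α₀, hα₀⟩ := hev d hd
    refine ⟨α₀, fun α hα => ?_⟩
    rw [← sub_mul]
    exact (abs_mul_le_abs_mul_abs_of_mul_nonneg hmul _ _).trans
      (mul_le_mul_right_of_mul_nonneg hmul (abs_nonneg y) (hα₀ α hα))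

theorem image_mul_right_neg {R : Type*} [NonUnitalRing R] (S : Set R) (u : R) :
    (fun s => s * u) '' (-S) = -((fun s => s * u) '' S) := by
  rw [← Set.image_neg_eq_neg, ← Set.image_neg_eq_neg, Set.image_image, Set.image_image]
  simp

end PositiveMultiplication

/-- For a Riesz algebra `E`, TFAE:
(i) `E` is a right d-algebra with right o-continuous multiplication;
(ii) `inf (A·u) = (inf A)·u` whenever `inf A` exists and `u ≥ 0`;
(iii) `sup (A·u) = (sup A)·u` whenever `sup A` exists and `u ≥ 0`. -/
theorem right_d_algebra_tfae {E : Type u}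
    [NonUnitalRing E] [Lattice E] [Module ℝ E]
    [CovariantClass E E (· + ·) (· ≤ ·)] [PosSMulMono ℝ E]
    [IsScalarTower ℝ E E] [SMulCommClass ℝ E E]
    (hmul : ∀ x y : E, 0 ≤ x → 0 ≤ y → 0 ≤ x * y) :
    ((∀ (x y u : E), 0 ≤ u → (x ⊓ y) * u = (x * u) ⊓ (y * u)) ∧
      (∀ (A : Type u) [Preorder A] [IsDirected A (· ≤ ·)] [Nonempty A],
        ∀ (xa : A → E) (x : E), OConv xa x → ∀ y : E, OConv (fun α => xa α * y) (x * y))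
     ↔ (∀ u : E, 0 ≤ u → ∀ (S : Set E) (a : E), IsGLB S a →
          IsGLB ((fun s => s * u) '' S) (a * u))) ∧
    ((∀ u : E, 0 ≤ u → ∀ (S : Set E) (a : E), IsGLB S a →
        IsGLB ((fun s => s * u) '' S) (a * u))
     ↔ (∀ u : E, 0 ≤ u → ∀ (S : Set E) (a : E), IsLUB S a →
          IsLUB ((fun s => s * u) '' S) (a * u))) := by
  refine ⟨⟨fun ⟨hinf, hcont⟩ u hu S a hS => ?_, fun h => ⟨fun x y u hu => ?_, ?_⟩⟩,
    fun h u hu S a hS => ?_, fun h u hu S a hS => ?_⟩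
  · exact isGLB_image_mul_right_of_oConv hmul hu (fun x y => hinf x y u hu)
      (fun A _ _ _ xa x hx => hcont A xa x hx u) hS
  · have := h u hu {x, y} (x ⊓ y) isGLB_pair
    rw [Set.image_pair] at this
    exact this.unique isGLB_pair
  · intro A _ _ _ xa x hx y
    exact hx.mul_right_of_isGLB hmul (h |y| (abs_nonneg y))
  · have := h u hu (-S) (-a) (isGLB_neg'.2 (by simpa using hS))
    rwa [image_mul_right_neg, neg_mul, isGLB_neg'] at this
  · have := h u hu (-S) (-a) (isLUB_neg'.2 (by simpa using hS))
    rwa [image_mul_right_neg, neg_mul, isLUB_neg'] at this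
end

section
/- Let E be a Riesz algebra such that for every u ∈ E_+ and every subset A ⊆ E for which inf A exists, the infimum of A·u = {a·u : a ∈ A} exists and equals (inf A)·u. Then o-convergence implies m_r o-convergence in E: whenever a net (x_α) o-converges to x in E, then |x_α − x|·u →o 0 for every u ∈ E_+. -/
universe u

/-- If in the Riesz algebra `E` the infimum distributes over right
multiplication by positive elements, then o-convergence implies m_r o-convergence. -/
theorem oConv_implies_mrOConv {E : Type u}
    [NonUnitalRing E] [Lattice E] [Module ℝ E]
    [CovariantClass E E (· + ·) (· ≤ ·)] [PosSMulMono ℝ E]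
    [IsScalarTower ℝ E E] [SMulCommClass ℝ E E]
    (hmul : ∀ x y : E, 0 ≤ x → 0 ≤ y → 0 ≤ x * y)
    (hdist : ∀ u : E, 0 ≤ u → ∀ (S : Set E) (a : E), IsGLB S a →
      IsGLB ((fun s => s * u) '' S) (a * u))
    {A : Type u} [Preorder A] [IsDirected A (· ≤ ·)] [Nonempty A]
    (x : A → E) (x₀ : E) (hx : OConv x x₀) :
    MrOConv x x₀ := by
  obtain ⟨D, ⟨d₀, hd₀⟩, hdir, hglb, hev⟩ := hx
  intro u hu
  have mul_mono : ∀ a b : E, a ≤ b → a * u ≤ b * u := fun a b hab => by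
    simpa [sub_mul] using hmul (b - a) u (sub_nonneg.mpr hab) hu
  refine ⟨(fun s => s * u) '' D, ⟨_, d₀, hd₀, rfl⟩, ?_, by simpa using hdist u hu D 0 hglb, ?_⟩
  · rintro _ ⟨a, ha, rfl⟩ _ ⟨b, hb, rfl⟩
    obtain ⟨c, hc, hca, hcb⟩ := hdir a ha b hb
    exact ⟨_, ⟨c, hc, rfl⟩, mul_mono c a hca, mul_mono c b hcb⟩
  · rintro _ ⟨d, hd, rfl⟩
    obtain ⟨α₀, hα₀⟩ := hev d hd
    refine ⟨α₀, fun α hα => ?_⟩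
    rw [sub_zero, abs_of_nonneg (hmul _ u (abs_nonneg _) hu)]
    exact mul_mono _ _ (hα₀ α hα)
end

section
/- Let E and F be Riesz algebras, and suppose E satisfies: for every u ∈ E_+ and every subset A ⊆ E for which inf A exists, the infimum of A·u = {a·u : a ∈ A} exists and equals (inf A)·u. Then every m_r o-continuous linear operator T : E → F is om_r o-continuous; that is, if T satisfies that x_α m_r o-converges to x implies Tx_α m_r o-converges to Tx, then also for every net (x_α) with x_α →o x in E, the net (Tx_α) m_r o-converges to Tx in F. -/
universe u

/-- If right multiplication by positive elements preserves infima, order convergence implies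
right multiplicative order convergence. -/
theorem OConv.mrOConv {E : Type u} [NonUnitalRing E] [Lattice E] [Module ℝ E]
    [AddLeftMono E] (hmul : ∀ x y : E, 0 ≤ x → 0 ≤ y → 0 ≤ x * y)
    (hdist : ∀ u : E, 0 ≤ u → ∀ (S : Set E) (a : E), IsGLB S a →
      IsGLB ((fun s => s * u) '' S) (a * u))
    {A : Type u} [Preorder A] {x : A → E} {x₀ : E} (hx : OConv x x₀) : MrOConv x x₀ := by
  intro u hu
  obtain ⟨D, hne, hdir, hglb, hD⟩ := hx
  have mul_mono : ∀ a b : E, a ≤ b → a * u ≤ b * u := fun a b hab => by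
    simpa [sub_mul] using hmul (b - a) u (sub_nonneg.mpr hab) hu
  refine ⟨(fun s => s * u) '' D, hne.image _, ?_, by simpa using hdist u hu D 0 hglb, ?_⟩
  · rintro _ ⟨a, ha, rfl⟩ _ ⟨b, hb, rfl⟩
    obtain ⟨c, hc, hca, hcb⟩ := hdir a ha b hb
    exact ⟨c * u, ⟨c, hc, rfl⟩, mul_mono c a hca, mul_mono c b hcb⟩
  · rintro _ ⟨d, hd, rfl⟩
    obtain ⟨α₀, hα₀⟩ := hD d hd
    refine ⟨α₀, fun α hα => ?_⟩
    rw [sub_zero, abs_of_nonneg (hmul _ _ (abs_nonneg _) hu)]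
    exact mul_mono _ _ (hα₀ α hα)

/-- If infima in `E` distribute over right multiplication by positive
elements, then every m_r o-continuous operator `T : E → F` is om_r o-continuous. -/
theorem mrOCont_implies_omrOCont {E F : Type u}
    [NonUnitalRing E] [Lattice E] [Module ℝ E]
    [CovariantClass E E (· + ·) (· ≤ ·)] [PosSMulMono ℝ E]
    [IsScalarTower ℝ E E] [SMulCommClass ℝ E E]
    (hmulE : ∀ x y : E, 0 ≤ x → 0 ≤ y → 0 ≤ x * y)
    [NonUnitalRing F] [Lattice F] [Module ℝ F]
    [CovariantClass F F (· + ·) (· ≤ ·)] [PosSMulMono ℝ F]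
    [IsScalarTower ℝ F F] [SMulCommClass ℝ F F]
    (hmulF : ∀ x y : F, 0 ≤ x → 0 ≤ y → 0 ≤ x * y)
    (hdist : ∀ u : E, 0 ≤ u → ∀ (S : Set E) (a : E), IsGLB S a →
      IsGLB ((fun s => s * u) '' S) (a * u))
    (T : E →ₗ[ℝ] F)
    (hT : ∀ (A : Type u) [Preorder A] [IsDirected A (· ≤ ·)] [Nonempty A],
      ∀ (x : A → E) (x₀ : E), MrOConv x x₀ → MrOConv (fun α => T (x α)) (T x₀))
    {A : Type u} [Preorder A] [IsDirected A (· ≤ ·)] [Nonempty A]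
    (x : A → E) (x₀ : E) (hx : OConv x x₀) :
    MrOConv (fun α => T (x α)) (T x₀) := by
  exact hT A x x₀ (hx.mrOConv hmulE hdist)
end

section
/- Let T : E → F be an mo-continuous linear operator between two Archimedean Riesz algebras. Then T is mo-bounded: for every order bounded subset B of E, the image T(B) is mo-bounded in F, i.e. for every w ∈ F_+ both sets w·T(B) and T(B)·w are order bounded in F. -/
universe u

section VectorLattice

variable {X : Type u} [Lattice X] [AddCommGroup X] [Module ℝ X] [PosSMulMono ℝ X]

lemma abs_smul_le_smul_of_abs_le {c : ℝ} (hc : 0 ≤ c) {y v : X} (hy : |y| ≤ v) :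
    |c • y| ≤ c • v := by
  refine sup_le (smul_le_smul_of_nonneg_left ((le_abs_self y).trans hy) hc) ?_
  rw [← smul_neg]
  exact smul_le_smul_of_nonneg_left ((neg_le_abs y).trans hy) hc

/-- In an Archimedean Riesz space, a net dominated by `(n + 1)⁻¹ • v` eventually for each `n`
order converges to `0`. -/
lemma ArchRiesz.oConv_zero [AddLeftMono X] (hX : ArchRiesz X) {v : X} (hv : 0 ≤ v)
    {A : Type u} [Preorder A] {x : A → X}
    (hx : ∀ n : ℕ, ∃ α₀ : A, ∀ α, α₀ ≤ α → |x α| ≤ ((n : ℝ) + 1)⁻¹ • v) :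
    OConv x 0 := by
  have hanti : Antitone fun n : ℕ => ((n : ℝ) + 1)⁻¹ • v := by
    intro m n hmn
    have hc : ((n : ℝ) + 1)⁻¹ ≤ ((m : ℝ) + 1)⁻¹ := by
      gcongr
    have h := smul_nonneg (sub_nonneg.2 hc) hv
    rw [sub_smul] at h
    exact sub_nonneg.1 h
  refine ⟨Set.range fun n : ℕ => ((n : ℝ) + 1)⁻¹ • v, Set.range_nonempty _, ?_, hX v hv, ?_⟩
  · rintro _ ⟨m, rfl⟩ _ ⟨n, rfl⟩
    exact ⟨_, ⟨max m n, rfl⟩, hanti (le_max_left m n), hanti (le_max_right m n)⟩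
  · rintro _ ⟨n, rfl⟩
    simpa using hx n

end VectorLattice

lemma abs_map_le_map_abs {X Y : Type*} [Lattice X] [AddCommGroup X] [AddLeftMono X]
    [Lattice Y] [AddCommGroup Y] [AddLeftMono Y] (f : X →+ Y)
    (hf : ∀ x, 0 ≤ x → 0 ≤ f x) (x : X) : |f x| ≤ f |x| := by
  have hmono : ∀ {a b : X}, a ≤ b → f a ≤ f b := fun h => by
    simpa [sub_nonneg] using hf _ (sub_nonneg.2 h)
  refine sup_le (hmono (le_abs_self x)) ?_
  rw [← map_neg]
  exact hmono (neg_le_abs x)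

/-- Pairs of an element of `[-v, v]` and a natural number, preordered by the latter. -/
structure ScaledBallIndex {E : Type u} [Lattice E] [AddGroup E] (v : E) where
  point : E
  abs_point_le : |point| ≤ v
  stage : ℕ

namespace ScaledBallIndex

variable {E : Type u} [Lattice E] [AddGroup E] {v : E}

instance : Preorder (ScaledBallIndex v) := Preorder.lift stage

instance : IsDirected (ScaledBallIndex v) (· ≤ ·) where
  directed i j := ⟨⟨i.point, i.abs_point_le, max i.stage j.stage⟩,
    le_max_left i.stage j.stage, le_max_right i.stage j.stage⟩

end ScaledBallIndex

/-- The net `(n + 1)⁻¹ • y`, for `|y| ≤ v`, vanishes in order under every positive map. -/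
lemma ScaledBallIndex.oConv_map_abs {E : Type u} [Lattice E] [AddCommGroup E] [Module ℝ E]
    [AddLeftMono E] [PosSMulMono ℝ E] (hE : ArchRiesz E) {v : E} (hv : 0 ≤ v)
    (f : E →ₗ[ℝ] E) (hf : ∀ x, 0 ≤ x → 0 ≤ f x) :
    OConv (fun i : ScaledBallIndex v => f |((i.stage : ℝ) + 1)⁻¹ • i.point|) 0 := by
  refine hE.oConv_zero (hf v hv) fun n =>
    ⟨⟨0, by simpa using hv, n⟩, fun i (hi : n ≤ i.stage) => ?_⟩
  have hc : ((i.stage : ℝ) + 1)⁻¹ ≤ ((n : ℝ) + 1)⁻¹ := by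
    gcongr
  have h0 : 0 ≤ ((i.stage : ℝ) + 1)⁻¹ := by positivity
  have hpt : |((i.stage : ℝ) + 1)⁻¹ • i.point| ≤ ((n : ℝ) + 1)⁻¹ • v := by
    refine (abs_smul_le_smul_of_abs_le h0 i.abs_point_le).trans ?_
    have h := smul_nonneg (sub_nonneg.2 hc) hv
    rw [sub_smul] at h
    exact sub_nonneg.1 h
  rw [abs_of_nonneg (hf _ (abs_nonneg _)), ← map_smul]
  have h := hf _ (sub_nonneg.2 hpt)
  rw [map_sub] at h
  exact sub_nonneg.1 h

/-- If a positive map `f` sends the absolute values of `T ((n + 1)⁻¹ • y)`, for `|y| ≤ v`, to a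
net order converging to `0`, then `f ∘ T` is order bounded on `[-v, v]`. -/
lemma ScaledBallIndex.ordBounded_image {E F : Type u} [Lattice E] [AddCommGroup E] [Module ℝ E]
    [Lattice F] [AddCommGroup F] [Module ℝ F] [AddLeftMono F] [PosSMulMono ℝ F]
    (T : E →ₗ[ℝ] F) (f : F →ₗ[ℝ] F) (hf : ∀ x, 0 ≤ x → 0 ≤ f x) {v : E}
    (h : OConv (fun i : ScaledBallIndex v => f |T (((i.stage : ℝ) + 1)⁻¹ • i.point)|) 0)
    {B : Set E} (hB : ∀ y ∈ B, |y| ≤ v) : OrdBounded (f '' (T '' B)) := by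
  obtain ⟨D, ⟨d, hd⟩, -, -, hD⟩ := h
  obtain ⟨i₀, hi₀⟩ := hD d hd
  set c : ℝ := (i₀.stage : ℝ) + 1 with hc
  have hc0 : 0 < c := by positivity
  have key : ∀ y ∈ B, |f (T y)| ≤ c • d := by
    intro y hy
    have h1 := hi₀ ⟨y, hB y hy, i₀.stage⟩ (le_refl i₀.stage)
    rw [sub_zero] at h1
    have h2 : |f (T (c⁻¹ • y))| ≤ d :=
      (abs_map_le_map_abs f.toAddMonoidHom hf _).trans ((le_abs_self _).trans h1)
    have h3 := abs_smul_le_smul_of_abs_le hc0.le h2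
    rwa [map_smul, map_smul, smul_inv_smul₀ hc0.ne'] at h3
  refine ⟨-(c • d), c • d, ?_⟩
  rintro _ ⟨_, ⟨y, hy, rfl⟩, rfl⟩
  exact ⟨neg_le.1 ((neg_le_abs _).trans (key y hy)), (le_abs_self _).trans (key y hy)⟩

/-- Every mo-continuous operator between Archimedean Riesz algebras is mo-bounded. -/
theorem moCont_implies_moBounded {E F : Type u}
    [NonUnitalRing E] [Lattice E] [Module ℝ E]
    [CovariantClass E E (· + ·) (· ≤ ·)] [PosSMulMono ℝ E]
    [IsScalarTower ℝ E E] [SMulCommClass ℝ E E]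
    (hmulE : ∀ x y : E, 0 ≤ x → 0 ≤ y → 0 ≤ x * y)
    (hArchE : ArchRiesz E)
    [NonUnitalRing F] [Lattice F] [Module ℝ F]
    [CovariantClass F F (· + ·) (· ≤ ·)] [PosSMulMono ℝ F]
    [IsScalarTower ℝ F F] [SMulCommClass ℝ F F]
    (hmulF : ∀ x y : F, 0 ≤ x → 0 ≤ y → 0 ≤ x * y)
    (hArchF : ArchRiesz F)
    (T : E →ₗ[ℝ] F)
    (hT : ∀ (A : Type u) [Preorder A] [IsDirected A (· ≤ ·)] [Nonempty A],
      ∀ (x : A → E) (x₀ : E), MOConv x x₀ → MOConv (fun α => T (x α)) (T x₀)) :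
    ∀ B : Set E, OrdBounded B → ∀ w : F, 0 ≤ w →
      OrdBounded ((fun y => w * y) '' (T '' B)) ∧
      OrdBounded ((fun y => y * w) '' (T '' B)) := by
  rintro B ⟨a, b, hB⟩ w hw
  have hEl : AddLeftMono E := ‹_›
  have hFl : AddLeftMono F := ‹_›
  set v : E := |a| ⊔ |b|
  have hv : 0 ≤ v := (abs_nonneg a).trans le_sup_left
  have hBv : ∀ y ∈ B, |y| ≤ v := fun y hy =>
    sup_le ((hB hy).2.trans ((le_abs_self b).trans le_sup_right))
      ((neg_le_neg_iff.2 (hB hy).1).trans ((neg_le_abs a).trans le_sup_left))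
  have : Nonempty (ScaledBallIndex v) := ⟨⟨0, by simpa using hv, 0⟩⟩
  have hx : MOConv (fun i : ScaledBallIndex v => ((i.stage : ℝ) + 1)⁻¹ • i.point) 0 := by
    constructor <;> intro u hu <;> simp only [sub_zero]
    · exact ScaledBallIndex.oConv_map_abs hArchE hv (LinearMap.mulLeft ℝ u)
        fun x hx => hmulE u x hu hx
    · exact ScaledBallIndex.oConv_map_abs hArchE hv (LinearMap.mulRight ℝ u)
        fun x hx => hmulE x u hx hu
  obtain ⟨hl, hr⟩ := hT _ _ _ hx
  have hl := hl w hw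
  have hr := hr w hw
  simp only [map_zero, sub_zero] at hl hr
  exact ⟨ScaledBallIndex.ordBounded_image T (LinearMap.mulLeft ℝ w)
      (fun x hx => hmulF w x hw hx) hl hBv,
    ScaledBallIndex.ordBounded_image T (LinearMap.mulRight ℝ w)
      (fun x hx => hmulF x w hx hw) hr hBv⟩
end

section
/- Let T : E → F be an omo-continuous linear operator between two Archimedean Riesz algebras. Then T is mo-bounded: for every order bounded subset B of E, the image T(B) is mo-bounded in F, i.e. for every w ∈ F_+ both sets w·T(B) and T(B)·w are order bounded in F. -/
universe u

section ScaledNet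

variable {E : Type u} [AddCommGroup E] [Lattice E] [Module ℝ E]

/-- Pairs `(n, x)` with `|x| ≤ u`, the index set of the net `(n, x) ↦ (n + 1)⁻¹ • x`. -/
def ScaledIndex (u : E) : Type u := {p : ℕ × E // |p.2| ≤ u}

instance (u : E) : Preorder (ScaledIndex u) := Preorder.lift fun p => p.1.1

instance (u : E) : IsDirected (ScaledIndex u) (· ≤ ·) :=
  ⟨fun p q => (le_total p.1.1 q.1.1).elim (fun h => ⟨q, h, le_refl q.1.1⟩)
    fun h => ⟨p, le_refl p.1.1, h⟩⟩

/-- The net `(n, x) ↦ (n + 1)⁻¹ • x`. -/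
noncomputable def scaledNet (u : E) (p : ScaledIndex u) : E :=
  ((p.1.1 : ℝ) + 1)⁻¹ • p.1.2

lemma inv_smul_antitone [AddLeftMono E] [PosSMulMono ℝ E] {u : E} (hu : 0 ≤ u) :
    Antitone fun n : ℕ => ((n : ℝ) + 1)⁻¹ • u := by
  intro m n hmn
  have h : (0 : ℝ) ≤ ((m : ℝ) + 1)⁻¹ - ((n : ℝ) + 1)⁻¹ := by
    rw [sub_nonneg]
    gcongr
  have := smul_nonneg h hu
  rwa [sub_smul, sub_nonneg] at this

lemma abs_smul_le_smul [PosSMulMono ℝ E] {r : ℝ} (hr : 0 ≤ r) {x u : E} (hx : |x| ≤ u) :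
    |r • x| ≤ r • u := by
  rw [abs_le'] at hx ⊢
  refine ⟨smul_le_smul_of_nonneg_left hx.1 hr, ?_⟩
  rw [← smul_neg]
  exact smul_le_smul_of_nonneg_left hx.2 hr

lemma oConv_scaledNet [AddLeftMono E] [PosSMulMono ℝ E] (hE : ArchRiesz E) {u : E}
    (hu : 0 ≤ u) : OConv (scaledNet u) 0 := by
  refine ⟨Set.range fun n : ℕ => ((n : ℝ) + 1)⁻¹ • u, Set.range_nonempty _, ?_, hE u hu, ?_⟩
  · rintro _ ⟨m, rfl⟩ _ ⟨n, rfl⟩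
    exact ⟨_, ⟨max m n, rfl⟩, inv_smul_antitone hu (le_max_left m n),
      inv_smul_antitone hu (le_max_right m n)⟩
  · rintro _ ⟨n, rfl⟩
    refine ⟨⟨(n, 0), by simpa using hu⟩, fun p hp => ?_⟩
    rw [sub_zero]
    exact (abs_smul_le_smul (by positivity) p.2).trans (inv_smul_antitone hu hp)

/-- A positive operator `G` sends `T '' B` to an order bounded set as soon as
`G |T x|` order converges to `0` along the scaled net of an order bound of `B`. -/
lemma ordBounded_image_of_oConv {F : Type u} [AddCommGroup F] [Lattice F] [Module ℝ F]
    [AddLeftMono F] [PosSMulMono ℝ F] (T : E →ₗ[ℝ] F) (G : F →ₗ[ℝ] F)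
    (hG : ∀ y, 0 ≤ y → 0 ≤ G y) {B : Set E} {u : E} (hB : ∀ x ∈ B, |x| ≤ u)
    (h : OConv (fun p => G |T (scaledNet u p) - T 0|) 0) :
    OrdBounded (G '' (T '' B)) := by
  obtain ⟨D, ⟨d, hd⟩, -, -, hD⟩ := h
  obtain ⟨p₀, hp₀⟩ := hD d hd
  set r : ℝ := (p₀.1.1 : ℝ) + 1 with hr
  have hr0 : 0 < r := by positivity
  refine ⟨-(r • d), r • d, ?_⟩
  rintro _ ⟨_, ⟨x, hx, rfl⟩, rfl⟩
  have hmono : ∀ a b, a ≤ b → G a ≤ G b := fun a b hab => by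
    simpa [sub_nonneg] using hG _ (sub_nonneg.2 hab)
  have h1 := hp₀ ⟨(p₀.1.1, x), hB x hx⟩ (le_refl p₀.1.1)
  simp only [scaledNet, map_zero, sub_zero, ← hr] at h1
  have h2 := (le_abs_self _).trans h1
  have h3 : G (T x) = r • G (T (r⁻¹ • x)) := by
    rw [map_smul, map_smul, smul_inv_smul₀ hr0.ne']
  rw [h3]
  refine ⟨?_, smul_le_smul_of_nonneg_left ((hmono _ _ (le_abs_self _)).trans h2) hr0.le⟩
  rw [neg_le, ← smul_neg, ← map_neg]
  exact smul_le_smul_of_nonneg_left ((hmono _ _ (neg_le_abs _)).trans h2) hr0.le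

end ScaledNet

/-- Every omo-continuous operator between Archimedean Riesz algebras is mo-bounded. -/
theorem omoCont_implies_moBounded {E F : Type u}
    [NonUnitalRing E] [Lattice E] [Module ℝ E]
    [CovariantClass E E (· + ·) (· ≤ ·)] [PosSMulMono ℝ E]
    [IsScalarTower ℝ E E] [SMulCommClass ℝ E E]
    (hmulE : ∀ x y : E, 0 ≤ x → 0 ≤ y → 0 ≤ x * y)
    (hArchE : ArchRiesz E)
    [NonUnitalRing F] [Lattice F] [Module ℝ F]
    [CovariantClass F F (· + ·) (· ≤ ·)] [PosSMulMono ℝ F]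
    [IsScalarTower ℝ F F] [SMulCommClass ℝ F F]
    (hmulF : ∀ x y : F, 0 ≤ x → 0 ≤ y → 0 ≤ x * y)
    (hArchF : ArchRiesz F)
    (T : E →ₗ[ℝ] F)
    (hT : ∀ (A : Type u) [Preorder A] [IsDirected A (· ≤ ·)] [Nonempty A],
      ∀ (x : A → E) (x₀ : E), OConv x x₀ → MOConv (fun α => T (x α)) (T x₀)) :
    ∀ B : Set E, OrdBounded B → ∀ w : F, 0 ≤ w →
      OrdBounded ((fun y => w * y) '' (T '' B)) ∧
      OrdBounded ((fun y => y * w) '' (T '' B)) := by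
  rintro B ⟨a, b, hB⟩ w hw
  have : AddLeftMono E := ⟨CovariantClass.elim⟩
  have : AddLeftMono F := ⟨CovariantClass.elim⟩
  have hu : 0 ≤ |a| ⊔ |b| := (abs_nonneg a).trans le_sup_left
  have hBu : ∀ x ∈ B, |x| ≤ |a| ⊔ |b| := fun x hx => abs_le'.2
    ⟨(hB hx).2.trans ((le_abs_self b).trans le_sup_right),
      (neg_le_neg_iff.2 (hB hx).1).trans ((neg_le_abs a).trans le_sup_left)⟩
  have : Nonempty (ScaledIndex (|a| ⊔ |b|)) := ⟨⟨(0, 0), by simpa using hu⟩⟩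
  obtain ⟨hl, hr⟩ := hT _ _ 0 (oConv_scaledNet hArchE hu)
  exact ⟨ordBounded_image_of_oConv T (LinearMap.mulLeft ℝ w) (fun y hy => hmulF w y hw hy)
      hBu (hl w hw),
    ordBounded_image_of_oConv T (LinearMap.mulRight ℝ w) (fun y hy => hmulF y w hy hw)
      hBu (hr w hw)⟩
end

section
/- Let E and F be Archimedean Riesz algebras and let T : E → F be a linear operator which is m_r o-continuous, or om_r o-continuous, or rm_r o-continuous. Then T is m_r o-bounded: for every order bounded subset B of E, the set T(B)·w is order bounded in F for every w ∈ F_+. -/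
universe u

section Regulator

variable {X : Type u} [Lattice X] [AddCommGroup X] [Module ℝ X] [PosSMulMono ℝ X]

lemma inv_succ_smul_antitone [CovariantClass X X (· + ·) (· ≤ ·)] {u : X} (hu : 0 ≤ u) :
    Antitone fun n : ℕ => ((n : ℝ) + 1)⁻¹ • u := by
  intro m n hmn
  have hmn' : ((n : ℝ) + 1)⁻¹ ≤ ((m : ℝ) + 1)⁻¹ := by gcongr
  have h : 0 ≤ (((m : ℝ) + 1)⁻¹ - ((n : ℝ) + 1)⁻¹) • u :=
    (smul_zero _).symm.le.trans (smul_le_smul_of_nonneg_left hu (sub_nonneg.2 hmn'))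
  rwa [sub_smul, sub_nonneg] at h

/-- In an Archimedean Riesz space, relatively uniform convergence implies order convergence. -/
lemma RConv.oConv_s10 [CovariantClass X X (· + ·) (· ≤ ·)] (hX : ArchRiesz X)
    {A : Type u} [Preorder A] {x : A → X} {x₀ : X} (h : RConv x x₀) : OConv x x₀ := by
  obtain ⟨u, hu, h⟩ := h
  refine ⟨_, Set.range_nonempty _, ?_, hX u hu, ?_⟩
  · rintro _ ⟨m, rfl⟩ _ ⟨n, rfl⟩
    exact ⟨_, ⟨max m n, rfl⟩, inv_succ_smul_antitone hu (le_max_left m n),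
      inv_succ_smul_antitone hu (le_max_right m n)⟩
  · rintro _ ⟨n, rfl⟩
    exact h n

lemma abs_smul_le_smul_of_nonneg [CovariantClass X X (· + ·) (· ≤ ·)] {r : ℝ} (hr : 0 ≤ r)
    {x c : X} (hx : |x| ≤ c) : |r • x| ≤ r • c := by
  rw [abs_le'] at hx ⊢
  rw [← smul_neg]
  exact ⟨smul_le_smul_of_nonneg_left hx.1 hr, smul_le_smul_of_nonneg_left hx.2 hr⟩

end Regulator

section Multiplication

variable {F : Type u} [NonUnitalRing F] [Lattice F] [CovariantClass F F (· + ·) (· ≤ ·)]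

lemma mul_le_mul_right_of_mul_nonneg_s10 (hmul : ∀ x y : F, 0 ≤ x → 0 ≤ y → 0 ≤ x * y)
    {x y w : F} (hxy : x ≤ y) (hw : 0 ≤ w) : x * w ≤ y * w := by
  rw [← sub_nonneg, ← sub_mul]
  exact hmul _ _ (sub_nonneg.2 hxy) hw

lemma abs_mul_le_abs_mul_of_nonneg (hmul : ∀ x y : F, 0 ≤ x → 0 ≤ y → 0 ≤ x * y)
    (x : F) {w : F} (hw : 0 ≤ w) : |x * w| ≤ |x| * w := by
  rw [abs_le', ← neg_mul]
  exact ⟨mul_le_mul_right_of_mul_nonneg_s10 hmul (le_abs_self x) hw,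
    mul_le_mul_right_of_mul_nonneg_s10 hmul (neg_le_abs x) hw⟩

/-- In an Archimedean Riesz algebra, relatively uniform convergence implies right multiplicative
order convergence. -/
lemma RConv.mrOConv [Module ℝ F] [PosSMulMono ℝ F] [IsScalarTower ℝ F F]
    (hmul : ∀ x y : F, 0 ≤ x → 0 ≤ y → 0 ≤ x * y) (hF : ArchRiesz F)
    {A : Type u} [Preorder A] {x : A → F} {x₀ : F} (h : RConv x x₀) : MrOConv x x₀ := by
  intro w hw
  obtain ⟨u, hu, h⟩ := h
  refine RConv.oConv_s10 hF ⟨u * w, hmul u w hu hw, fun n => ?_⟩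
  obtain ⟨α₀, hα₀⟩ := h n
  refine ⟨α₀, fun α hα => ?_⟩
  rw [sub_zero, abs_of_nonneg (hmul _ _ (abs_nonneg _) hw), ← smul_mul_assoc]
  exact mul_le_mul_right_of_mul_nonneg_s10 hmul (hα₀ α hα) hw

end Multiplication

/-- Pairs of a natural number and an element of `S`, preordered by the number alone. -/
structure NatIndexed (S : Type u) : Type u where
  index : ℕ
  point : S

namespace NatIndexed

variable {S : Type u}

instance : Preorder (NatIndexed S) := Preorder.lift index

lemma le_def {p q : NatIndexed S} : p ≤ q ↔ p.index ≤ q.index := Iff.rfl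

instance : IsDirected (NatIndexed S) (· ≤ ·) :=
  ⟨fun p q => (le_total p.index q.index).elim (fun h => ⟨q, h, le_refl q⟩) fun h => ⟨p, le_refl p, h⟩⟩

instance [Nonempty S] : Nonempty (NatIndexed S) := ‹Nonempty S›.map (NatIndexed.mk 0)

end NatIndexed

/-- The net of all `(n + 1)⁻¹ • x` with `x` in the order interval given by `c`. -/
noncomputable def shrinkingNet {X : Type u} [Lattice X] [AddCommGroup X] [Module ℝ X] (c : X)
    (p : NatIndexed {x : X // |x| ≤ c}) : X :=
  ((p.index : ℝ) + 1)⁻¹ • (p.point : X)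

lemma rConv_shrinkingNet {X : Type u} [Lattice X] [AddCommGroup X] [Module ℝ X]
    [CovariantClass X X (· + ·) (· ≤ ·)] [PosSMulMono ℝ X] {c : X} (hc : 0 ≤ c) :
    RConv (shrinkingNet c) 0 := by
  refine ⟨c, hc, fun n => ⟨⟨n, 0, by simpa using hc⟩, fun p hp => ?_⟩⟩
  rw [sub_zero]
  exact (abs_smul_le_smul_of_nonneg (by positivity) p.point.2).trans
    (inv_succ_smul_antitone hc (NatIndexed.le_def.1 hp))

/-- Every m_r o-, om_r o-, or rm_r o-continuous operator between
Archimedean Riesz algebras is m_r o-bounded. -/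
theorem mrOCont_or_omrOCont_or_rmrOCont_implies_mrOBounded {E F : Type u}
    [NonUnitalRing E] [Lattice E] [Module ℝ E]
    [CovariantClass E E (· + ·) (· ≤ ·)] [PosSMulMono ℝ E]
    [IsScalarTower ℝ E E] [SMulCommClass ℝ E E]
    (hmulE : ∀ x y : E, 0 ≤ x → 0 ≤ y → 0 ≤ x * y)
    (hArchE : ArchRiesz E)
    [NonUnitalRing F] [Lattice F] [Module ℝ F]
    [CovariantClass F F (· + ·) (· ≤ ·)] [PosSMulMono ℝ F]
    [IsScalarTower ℝ F F] [SMulCommClass ℝ F F]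
    (hmulF : ∀ x y : F, 0 ≤ x → 0 ≤ y → 0 ≤ x * y)
    (hArchF : ArchRiesz F)
    (T : E →ₗ[ℝ] F)
    (hT : (∀ (A : Type u) [Preorder A] [IsDirected A (· ≤ ·)] [Nonempty A],
            ∀ (x : A → E) (x₀ : E), MrOConv x x₀ → MrOConv (fun α => T (x α)) (T x₀)) ∨
          (∀ (A : Type u) [Preorder A] [IsDirected A (· ≤ ·)] [Nonempty A],
            ∀ (x : A → E) (x₀ : E), OConv x x₀ → MrOConv (fun α => T (x α)) (T x₀)) ∨
          (∀ (A : Type u) [Preorder A] [IsDirected A (· ≤ ·)] [Nonempty A],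
            ∀ (x : A → E) (x₀ : E), RConv x x₀ → MrOConv (fun α => T (x α)) (T x₀))) :
    ∀ B : Set E, OrdBounded B → ∀ w : F, 0 ≤ w →
      OrdBounded ((fun y => y * w) '' (T '' B)) := by
  intro B ⟨a, b, hB⟩ w hw
  set c : E := |a| ⊔ |b|
  have hc : 0 ≤ c := (abs_nonneg a).trans le_sup_left
  have hBc : ∀ x ∈ B, |x| ≤ c := fun x hx => abs_le'.2
    ⟨(hB hx).2.trans ((le_abs_self b).trans le_sup_right),
      (neg_le_neg_iff.2 (hB hx).1).trans ((neg_le_abs a).trans le_sup_left)⟩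
  have : Nonempty {x : E // |x| ≤ c} := ⟨⟨0, by simpa using hc⟩⟩
  have hr := rConv_shrinkingNet hc
  have hconv : MrOConv (fun p => T (shrinkingNet c p)) (T 0) := by
    rcases hT with hT | hT | hT
    · exact hT _ _ _ (hr.mrOConv hmulE hArchE)
    · exact hT _ _ _ (hr.oConv_s10 hArchE)
    · exact hT _ _ _ hr
  obtain ⟨D, ⟨d, hd⟩, -, -, hD⟩ := hconv w hw
  obtain ⟨p, hp⟩ := hD d hd
  set r : ℝ := (p.index : ℝ) + 1
  have hr_pos : 0 < r := by positivity
  have hbound : ∀ x ∈ B, |T x * w| ≤ r • d := by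
    intro x hx
    have h : |(|T (r⁻¹ • x) - T 0| * w) - 0| ≤ d :=
      hp ⟨p.index, x, hBc x hx⟩ (NatIndexed.le_def.2 le_rfl)
    rw [map_zero, sub_zero, sub_zero] at h
    replace h : |r⁻¹ • (T x * w)| ≤ d := by
      rw [← smul_mul_assoc, ← map_smul]
      exact (abs_mul_le_abs_mul_of_nonneg hmulF _ hw).trans ((le_abs_self _).trans h)
    simpa [smul_smul, hr_pos.ne'] using abs_smul_le_smul_of_nonneg hr_pos.le h
  refine ⟨-(r • d), r • d, ?_⟩
  rintro _ ⟨_, ⟨x, hx, rfl⟩, rfl⟩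
  have h := abs_le'.1 (hbound x hx)
  exact ⟨neg_le.1 h.2, h.1⟩
end

section
/- Let E and F be Riesz algebras and let T : E → F be a positive linear operator which is a quasi m_l o-Levi operator. Then every linear operator S : E → F with 0 ≤ S ≤ T (i.e. 0 ≤ Sx ≤ Tx for all x ≥ 0) is also a quasi m_l o-Levi operator. -/
universe u

section Levi

variable {E F : Type u}
  [NonUnitalRing E] [Lattice E] [Module ℝ E]
  [NonUnitalRing F] [Lattice F] [Module ℝ F]

/-- `T : E → F` is a quasi m_l o-Levi operator: for every increasing net in `E_+`
whose range is m_l o-bounded, the net `T x_α` is m_l o-Cauchy. -/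
def QuasiMlOLevi (T : E →ₗ[ℝ] F) : Prop :=
  ∀ (A : Type u) [Preorder A] [IsDirected A (· ≤ ·)] [Nonempty A],
    ∀ xa : A → E, Monotone xa → (∀ α, 0 ≤ xa α) →
      (∀ u : E, 0 ≤ u → OrdBounded ((fun a => u * a) '' Set.range xa)) →
      MlOCauchy (fun α => T (xa α))

end Levi

/-- Left multiplication by a positive element is monotone as soon as products of positive
elements are positive. -/
theorem mul_le_mul_left_of_mul_nonneg {F : Type u} [NonUnitalRing F] [Lattice F]
    [IsOrderedAddMonoid F] (hmul : ∀ x y : F, 0 ≤ x → 0 ≤ y → 0 ≤ x * y)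
    {u x y : F} (hu : 0 ≤ u) (hxy : x ≤ y) : u * x ≤ u * y := by
  have h := hmul u (y - x) hu (sub_nonneg.mpr hxy)
  rwa [mul_sub, sub_nonneg] at h

/-- If the increments of `s` along an increasing pair of indices are positive and dominated by
those of `t`, and `t` is `m_l o`-Cauchy, then so is `s`. -/
theorem MlOCauchy.of_increments_le {F : Type u} [NonUnitalRing F] [Lattice F]
    [IsOrderedAddMonoid F] (hmul : ∀ x y : F, 0 ≤ x → 0 ≤ y → 0 ≤ x * y)
    {A : Type u} [Preorder A] [IsDirected A (· ≤ ·)] {s t : A → F} (hs : Monotone s)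
    (hst : ∀ α β, α ≤ β → s β - s α ≤ t β - t α) (ht : MlOCauchy t) : MlOCauchy s := by
  intro u hu
  obtain ⟨D, hne, hdir, hglb, hD⟩ := ht u hu
  refine ⟨D, hne, hdir, hglb, fun d hd => ?_⟩
  obtain ⟨α₀, h₀⟩ := hD d hd
  refine ⟨α₀, fun α₁ h₁ α₂ h₂ => ?_⟩
  obtain ⟨γ, h₁γ, h₂γ⟩ := exists_ge_ge α₁ α₂
  have h₀γ := h₁.trans h₁γ
  have habs : |s α₁ - s α₂| ≤ s γ - s α₀ := by
    refine abs_le'.mpr ⟨sub_le_sub (hs h₁γ) (hs h₂), ?_⟩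
    rw [neg_sub]
    exact sub_le_sub (hs h₂γ) (hs h₁)
  exact (mul_le_mul_left_of_mul_nonneg hmul hu
    (habs.trans ((hst α₀ γ h₀γ).trans (le_abs_self _)))).trans (h₀ γ h₀γ α₀ le_rfl)

/-- If `T : E → F` is a positive quasi m_l o-Levi operator between Riesz
algebras and `0 ≤ S ≤ T`, then `S` is a quasi m_l o-Levi operator. -/
theorem quasi_mlOLevi_domination {E F : Type u}
    [NonUnitalRing E] [Lattice E] [Module ℝ E]
    [CovariantClass E E (· + ·) (· ≤ ·)] [PosSMulMono ℝ E]
    [IsScalarTower ℝ E E] [SMulCommClass ℝ E E]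
    (hmulE : ∀ x y : E, 0 ≤ x → 0 ≤ y → 0 ≤ x * y)
    [NonUnitalRing F] [Lattice F] [Module ℝ F]
    [CovariantClass F F (· + ·) (· ≤ ·)] [PosSMulMono ℝ F]
    [IsScalarTower ℝ F F] [SMulCommClass ℝ F F]
    (hmulF : ∀ x y : F, 0 ≤ x → 0 ≤ y → 0 ≤ x * y)
    (T S : E →ₗ[ℝ] F)
    (hTpos : ∀ x : E, 0 ≤ x → 0 ≤ T x)
    (hTLevi : QuasiMlOLevi T)
    (hS : ∀ x : E, 0 ≤ x → 0 ≤ S x ∧ S x ≤ T x) :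
    QuasiMlOLevi S := by
  have : IsOrderedAddMonoid E := ⟨fun _ _ h c => by
    rw [add_comm _ c, add_comm _ c]; exact CovariantClass.elim c h,
    fun _ _ h c => CovariantClass.elim c h⟩
  have : IsOrderedAddMonoid F := ⟨fun _ _ h c => by
    rw [add_comm _ c, add_comm _ c]; exact CovariantClass.elim c h,
    fun _ _ h c => CovariantClass.elim c h⟩
  intro A _ _ _ xa hmono hpos hbdd
  have hinc : ∀ α β, α ≤ β → 0 ≤ xa β - xa α := fun _ _ h => sub_nonneg.mpr (hmono h)
  refine MlOCauchy.of_increments_le hmulF (fun α β h => ?_) (fun α β h => ?_)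
    (hTLevi A xa hmono hpos hbdd)
  · rw [← sub_nonneg, ← map_sub]
    exact (hS _ (hinc α β h)).1
  · rw [← map_sub, ← map_sub]
    exact (hS _ (hinc α β h)).2
end

section
/- Let E and F be Riesz algebras and let T : E → F be a positive linear operator which is a quasi mo-Levi operator. Then every linear operator S : E → F with 0 ≤ S ≤ T (i.e. 0 ≤ Sx ≤ Tx for all x ≥ 0) is also a quasi mo-Levi operator. -/
universe u

section Levi

variable {E F : Type u}
  [NonUnitalRing E] [Lattice E] [Module ℝ E]
  [NonUnitalRing F] [Lattice F] [Module ℝ F]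

/-- `T : E → F` is a quasi mo-Levi operator: for every increasing net in `E_+`
whose range is mo-bounded, the net `T x_α` is mo-Cauchy. -/
def QuasiMoLevi (T : E →ₗ[ℝ] F) : Prop :=
  ∀ (A : Type u) [Preorder A] [IsDirected A (· ≤ ·)] [Nonempty A],
    ∀ xa : A → E, Monotone xa → (∀ α, 0 ≤ xa α) →
      (∀ u : E, 0 ≤ u → OrdBounded ((fun a => u * a) '' Set.range xa) ∧
        OrdBounded ((fun a => a * u) '' Set.range xa)) →
      MOCauchy (fun α => T (xa α))

end Levi

/-- If `T : E → F` is a positive quasi mo-Levi operator between Riesz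
algebras and `0 ≤ S ≤ T`, then `S` is a quasi mo-Levi operator. -/
theorem quasi_moLevi_domination {E F : Type u}
    [NonUnitalRing E] [Lattice E] [Module ℝ E]
    [CovariantClass E E (· + ·) (· ≤ ·)] [PosSMulMono ℝ E]
    [IsScalarTower ℝ E E] [SMulCommClass ℝ E E]
    (hmulE : ∀ x y : E, 0 ≤ x → 0 ≤ y → 0 ≤ x * y)
    [NonUnitalRing F] [Lattice F] [Module ℝ F]
    [CovariantClass F F (· + ·) (· ≤ ·)] [PosSMulMono ℝ F]
    [IsScalarTower ℝ F F] [SMulCommClass ℝ F F]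
    (hmulF : ∀ x y : F, 0 ≤ x → 0 ≤ y → 0 ≤ x * y)
    (T S : E →ₗ[ℝ] F)
    (hTpos : ∀ x : E, 0 ≤ x → 0 ≤ T x)
    (hTLevi : QuasiMoLevi T)
    (hS : ∀ x : E, 0 ≤ x → 0 ≤ S x ∧ S x ≤ T x) :
    QuasiMoLevi S := by
  intro A _ _ _ xa hmono hpos hbdd u hu
  obtain ⟨D, hne, hdir, hglb, hD⟩ := hTLevi A xa hmono hpos hbdd u hu
  refine ⟨D, hne, hdir, hglb, fun d hd => ?_⟩
  obtain ⟨α₀, hα₀⟩ := hD d hd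
  refine ⟨α₀, fun α₁ h₁ α₂ h₂ => ?_⟩
  obtain ⟨α₃, h₁₃, h₂₃⟩ := exists_ge_ge α₁ α₂
  have hS_mono : ∀ {x y : E}, x ≤ y → S x ≤ S y := fun {x y} hxy => by
    simpa using (hS (y - x) (sub_nonneg.2 hxy)).1
  have hST : S (xa α₃) - S (xa α₀) ≤ T (xa α₃) - T (xa α₀) := by
    simpa using (hS _ (sub_nonneg.2 (hmono (h₁.trans h₁₃)))).2
  have hdom : |S (xa α₁) - S (xa α₂)| ≤ |T (xa α₃) - T (xa α₀)| := by
    refine le_trans ?_ (hST.trans (le_abs_self _))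
    refine abs_le'.2 ⟨?_, ?_⟩
    · exact sub_le_sub (hS_mono (hmono h₁₃)) (hS_mono (hmono h₂))
    · rw [neg_sub]
      exact sub_le_sub (hS_mono (hmono h₂₃)) (hS_mono (hmono h₁))
  obtain ⟨hl, hr⟩ := hα₀ α₃ (h₁.trans h₁₃) α₀ le_rfl
  constructor
  · refine le_trans (sub_nonneg.1 ?_) hl
    rw [← mul_sub]
    exact hmulF _ _ hu (sub_nonneg.2 hdom)
  · refine le_trans (sub_nonneg.1 ?_) hr
    rw [← sub_mul]
    exact hmulF _ _ (sub_nonneg.2 hdom) hu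
end

section
/- Let E be a unital Riesz algebra (E has a positive multiplicative identity) and F a Riesz algebra. Then every om_r o-continuous linear operator T : E → F is m_r o-continuous: if x_α m_r o-converges to x in E, then Tx_α m_r o-converges to Tx in F. -/
universe u

/-- If the Riesz algebra E is unital, then every om_r o-continuous operator T : E → F is m_r o-continuous. -/
theorem omrOCont_implies_mrOCont_of_unital {E F : Type u}
    [NonUnitalRing E] [Lattice E] [Module ℝ E]
    [CovariantClass E E (· + ·) (· ≤ ·)] [PosSMulMono ℝ E]
    [IsScalarTower ℝ E E] [SMulCommClass ℝ E E]
    (hmulE : ∀ x y : E, 0 ≤ x → 0 ≤ y → 0 ≤ x * y)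
    [NonUnitalRing F] [Lattice F] [Module ℝ F]
    [CovariantClass F F (· + ·) (· ≤ ·)] [PosSMulMono ℝ F]
    [IsScalarTower ℝ F F] [SMulCommClass ℝ F F]
    (hmulF : ∀ x y : F, 0 ≤ x → 0 ≤ y → 0 ≤ x * y)
    (hE : ∃ e : E, 0 ≤ e ∧ (∀ x : E, e * x = x) ∧ (∀ x : E, x * e = x))
    (T : E →ₗ[ℝ] F)
    (hT : ∀ (A : Type u) [Preorder A] [IsDirected A (· ≤ ·)] [Nonempty A],
      ∀ (x : A → E) (x₀ : E), OConv x x₀ → MrOConv (fun α => T (x α)) (T x₀))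
    {A : Type u} [Preorder A] [IsDirected A (· ≤ ·)] [Nonempty A]
    (x : A → E) (x₀ : E) (hx : MrOConv x x₀) :
    MrOConv (fun α => T (x α)) (T x₀) := by
  obtain ⟨e, he, -, hmul_e⟩ := hE
  refine hT A x x₀ ?_
  obtain ⟨D, hne, hdir, hglb, hD⟩ := hx e he
  refine ⟨D, hne, hdir, hglb, fun d hd => ?_⟩
  obtain ⟨α₀, hα₀⟩ := hD d hd
  refine ⟨α₀, fun α hα => ?_⟩
  have h := hα₀ α hα
  simp only [hmul_e, sub_zero] at h
  exact (le_abs_self _).trans h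
end
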